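/- Assume B : (0,∞) → [0,∞) is continuous and bounded on some neighborhood of 0. Let µ be a positive Borel measure on (0,∞) with ∫₀^∞ x dµ(x) < ∞ and let t ≥ 0. Then the set function µM_t : A ↦ ∫₀^∞ M_t 1_A dµ is a countably additive positive Borel measure on (0,∞), it satisfies ∫₀^∞ x d(µM_t)(x) = e^t ∫₀^∞ x dµ(x) < ∞, and (µM_t)(f) = µ(M_t f) := ∫₀^∞ M_t f dµ for every Borel function f with ‖f‖_Ḃ < ∞. -/

import Mathlib

open MeasureTheory Real Set Filter Topology

noncomputable section

/-- A function on `(0,∞)` is locally bounded if it is bounded on the intersection of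
`(0,∞)` with every bounded set. -/
def LocBddOn (f : ℝ → ℝ) : Prop :=
  ∀ r > 0, ∃ C, ∀ x, 0 < x → x ≤ r → |f x| ≤ C

/-- A function on `[0,∞) × (0,∞)` is locally bounded if it is bounded on the intersection of
`[0,∞) × (0,∞)` with every bounded set. -/
def LocBdd2 (φ : ℝ → ℝ → ℝ) : Prop :=
  ∀ r > 0, ∃ C, ∀ t x, 0 ≤ t → t ≤ r → 0 < x → x ≤ r → |φ t x| ≤ C

/-- Mild solution of the dual mitosis equation with initial datum `f`. -/
def IsMildSol (B f : ℝ → ℝ) (φ : ℝ → ℝ → ℝ) : Prop :=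
  ∀ t ≥ 0, ∀ x > 0,
    φ t x = f (x * exp t) * Real.exp (-∫ s in (0:ℝ)..t, B (x * exp s))
      + 2 * ∫ τ in (0:ℝ)..t,
          B (x * exp τ) * Real.exp (-∫ s in (0:ℝ)..τ, B (x * exp s)) * φ (t - τ) (x * exp τ / 2)

/-- `B : (0,∞) → [0,∞)` is continuous and bounded on some neighborhood of `0`. -/
def Bhyp (B : ℝ → ℝ) : Prop :=
  ContinuousOn B (Ioi 0) ∧ (∀ x > 0, 0 ≤ B x) ∧
    ∃ ε > 0, ∃ C, ∀ x, 0 < x → x < ε → B x ≤ C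


namespace Mito

/-- survival factor along a characteristic, in logarithmic coordinates -/
def E (β : ℝ → ℝ) (a s t : ℝ) : ℝ := Real.exp (-∫ r in s..t, β (a - r))

/-- weights of the series representation -/
def P (β : ℝ → ℝ) : ℕ → ℝ → ℝ → ℝ
  | 0 => fun a t => E β a 0 t
  | n + 1 => fun a t => 2 * ∫ s in (0:ℝ)..t, β (a - s) * E β a s t * P β n (a - Real.log 2) s

theorem E_split {β : ℝ → ℝ} (hβ : Continuous β) (a s t : ℝ) :
    E β a s t = E β a 0 t * Real.exp (∫ r in (0:ℝ)..s, β (a - r)) := by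
  have hc : Continuous fun r => β (a - r) := by fun_prop
  have := intervalIntegral.integral_add_adjacent_intervals
    (hc.intervalIntegrable (μ := volume) 0 s) (hc.intervalIntegrable (μ := volume) s t)
  unfold E
  rw [← Real.exp_add, ← this]
  congr 1; ring

theorem cont_int {β : ℝ → ℝ} (hβ : Continuous β) :
    Continuous fun p : ℝ × ℝ => ∫ r in (0:ℝ)..p.2, β (p.1 - r) := by
  apply intervalIntegral.continuous_parametric_intervalIntegral_of_continuous
  · fun_prop
  · fun_prop

theorem cont_E0 {β : ℝ → ℝ} (hβ : Continuous β) :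
    Continuous fun p : ℝ × ℝ => E β p.1 0 p.2 := by
  unfold E
  exact Real.continuous_exp.comp (cont_int hβ).neg

theorem cont_E {β : ℝ → ℝ} (hβ : Continuous β) :
    Continuous fun p : ℝ × ℝ × ℝ => E β p.1 p.2.1 p.2.2 := by
  have : (fun p : ℝ × ℝ × ℝ => E β p.1 p.2.1 p.2.2) = fun p : ℝ × ℝ × ℝ =>
      E β p.1 0 p.2.2 * Real.exp (∫ r in (0:ℝ)..p.2.1, β (p.1 - r)) := by
    funext p; exact E_split hβ _ _ _
  rw [this]
  have h1 : Continuous fun p : ℝ × ℝ × ℝ => E β p.1 0 p.2.2 :=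
    (cont_E0 hβ).comp (by fun_prop : Continuous fun p : ℝ × ℝ × ℝ => (p.1, p.2.2))
  have h2 : Continuous fun p : ℝ × ℝ × ℝ => ∫ r in (0:ℝ)..p.2.1, β (p.1 - r) :=
    (cont_int hβ).comp (by fun_prop : Continuous fun p : ℝ × ℝ × ℝ => (p.1, p.2.1))
  exact h1.mul (Real.continuous_exp.comp h2)

theorem cont_P {β : ℝ → ℝ} (hβ : Continuous β) (n : ℕ) :
    Continuous fun p : ℝ × ℝ => P β n p.1 p.2 := by
  induction n with
  | zero => exact cont_E0 hβ
  | succ n ih =>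
    simp only [P]
    refine continuous_const.mul ?_
    apply intervalIntegral.continuous_parametric_intervalIntegral_of_continuous
      (f := fun (p : ℝ × ℝ) s => β (p.1 - s) * E β p.1 s p.2 * P β n (p.1 - Real.log 2) s)
    · have h1 : Continuous fun q : (ℝ × ℝ) × ℝ => E β q.1.1 q.2 q.1.2 :=
        (cont_E hβ).comp
          (by fun_prop : Continuous fun q : (ℝ × ℝ) × ℝ => (q.1.1, q.2, q.1.2))
      have h2 : Continuous fun q : (ℝ × ℝ) × ℝ => P β n (q.1.1 - Real.log 2) q.2 :=
        ih.comp (by fun_prop : Continuous fun q : (ℝ × ℝ) × ℝ => (q.1.1 - Real.log 2, q.2))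
      have h3 : Continuous fun q : (ℝ × ℝ) × ℝ => β (q.1.1 - q.2) := by fun_prop
      exact (h3.mul h1).mul h2
    · fun_prop

theorem E_pos (β : ℝ → ℝ) (a s t : ℝ) : 0 < E β a s t := Real.exp_pos _

theorem E_le_one {β : ℝ → ℝ} (h0 : ∀ a, 0 ≤ β a) (a : ℝ) {s t : ℝ} (h : s ≤ t) :
    E β a s t ≤ 1 := by
  unfold E
  rw [Real.exp_le_one_iff, neg_nonpos]
  exact intervalIntegral.integral_nonneg h fun _ _ => h0 _

theorem P_nonneg {β : ℝ → ℝ} (h0 : ∀ a, 0 ≤ β a) (n : ℕ) (a : ℝ) {t : ℝ} (ht : 0 ≤ t) :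
    0 ≤ P β n a t := by
  induction n generalizing a t with
  | zero => exact (E_pos _ _ _ _).le
  | succ n ih =>
    simp only [P]
    refine mul_nonneg (by norm_num) (intervalIntegral.integral_nonneg ht fun s hs => ?_)
    exact mul_nonneg (mul_nonneg (h0 _) (E_pos _ _ _ _).le) (ih _ hs.1)

/-- the primitive of any function (with the junk value convention) is measurable on `[0,∞)` -/
theorem meas_prim (K : ℝ → ℝ) :
    Measurable ((Ici (0:ℝ)).indicator fun t => ∫ s in (0:ℝ)..t, K s) := by
  set S : Set ℝ := {t | 0 ≤ t ∧ IntervalIntegrable K volume 0 t} with hS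
  have hmono : ∀ t ∈ S, ∀ s, 0 ≤ s → s ≤ t → s ∈ S := fun t ht s h0 hs =>
    ⟨h0, ht.2.mono_set (by rw [uIcc_of_le h0, uIcc_of_le ht.1]; exact Icc_subset_Icc_right hs)⟩
  have hSm : MeasurableSet S := by
    apply Set.OrdConnected.measurableSet
    constructor
    intro x hx y hy z hz
    exact hmono y hy z (hx.1.trans hz.1) hz.2
  have hc0 : ∀ t ∈ S, ContinuousOn (fun t => ∫ s in (0:ℝ)..t, K s) (Icc 0 t) := by
    intro t ht
    have := intervalIntegral.continuousOn_primitive_interval' (a := 0) ht.2 (by simp)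
    rwa [uIcc_of_le ht.1] at this
  have hc : ContinuousOn (fun t => ∫ s in (0:ℝ)..t, K s) S := by
    intro t ht
    by_cases h : ∃ t' ∈ S, t < t'
    · obtain ⟨t', ht', hlt⟩ := h
      refine (hc0 t' ht' t ⟨ht.1, hlt.le⟩).mono_of_mem_nhdsWithin ?_
      filter_upwards [self_mem_nhdsWithin, mem_nhdsWithin_of_mem_nhds (Iio_mem_nhds hlt)]
        with s hs hs'
      exact ⟨hs.1, le_of_lt hs'⟩
    · push Not at h
      exact (hc0 t ht t ⟨ht.1, le_rfl⟩).mono fun s hs => ⟨hs.1, h s hs⟩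
  have heq : (Ici (0:ℝ)).indicator (fun t => ∫ s in (0:ℝ)..t, K s)
      = S.indicator fun t => ∫ s in (0:ℝ)..t, K s := by
    funext t
    by_cases h : t ∈ S
    · rw [indicator_of_mem h, indicator_of_mem (show t ∈ Ici (0:ℝ) from h.1)]
    · rw [indicator_of_notMem h]
      by_cases h0 : 0 ≤ t
      · rw [indicator_of_mem (show t ∈ Ici (0:ℝ) from h0)]
        apply intervalIntegral.integral_undef
        exact fun h' => h ⟨h0, h'⟩
      · exact indicator_of_notMem h0 _
  rw [heq]
  classical
  rw [← Set.piecewise_eq_indicator]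
  exact hc.measurable_piecewise continuousOn_const hSm

end Mito

namespace Mito

theorem U_int {β F : ℝ → ℝ} {U : ℝ → ℝ → ℝ} (hβ : Continuous β)
    (hU : ∀ a t, 0 ≤ t → U a t = F a * E β a 0 t
      + 2 * ∫ s in (0:ℝ)..t, β (a - s) * E β a s t * U (a - Real.log 2) s)
    (hbd : ∀ a0 T, ∃ K, ∀ a ≤ a0, ∀ t, 0 ≤ t → t ≤ T → |U a t| ≤ K) (a t : ℝ) (ht : 0 ≤ t) :
    IntervalIntegrable (U a) volume 0 t := by
  have hm : Measurable ((Ici (0:ℝ)).indicator (U a)) := by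
    have : (Ici (0:ℝ)).indicator (U a) = fun t => E β a 0 t *
        ((Ici (0:ℝ)).indicator (fun _ => F a) t + 2 * (Ici (0:ℝ)).indicator
          (fun t => ∫ s in (0:ℝ)..t, β (a - s) * Real.exp (∫ r in (0:ℝ)..s, β (a - r))
            * U (a - Real.log 2) s) t) := by
      funext t
      by_cases h : t ∈ Ici (0:ℝ)
      · simp only [indicator_of_mem h]
        rw [hU a t h, mul_add, mul_comm (F a)]
        congr 1
        rw [mul_left_comm]
        congr 1
        rw [← intervalIntegral.integral_const_mul]
        congr 1
        funext s
        rw [E_split hβ a s t]; ring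
      · simp only [indicator_of_notMem h]; simp
    rw [this]
    have h1 : Continuous fun t => E β a 0 t :=
      (cont_E0 hβ).comp (by fun_prop : Continuous fun t : ℝ => (a, t))
    exact h1.measurable.mul (((measurable_const).indicator measurableSet_Ici).add
      ((meas_prim _).const_mul 2))
  obtain ⟨K, hK⟩ := hbd a t
  have hi : IntegrableOn ((Ici (0:ℝ)).indicator (U a)) (Ioc 0 t) volume := by
    apply Measure.integrableOn_of_bounded (M := K) (by simp) hm.aestronglyMeasurable
    filter_upwards [ae_restrict_mem measurableSet_Ioc] with s hs
    rw [indicator_of_mem (show s ∈ Ici (0:ℝ) from hs.1.le)]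
    exact hK a le_rfl s hs.1.le hs.2
  rw [intervalIntegrable_iff_integrableOn_Ioc_of_le ht]
  refine hi.congr_fun (fun s hs => ?_) measurableSet_Ioc
  rw [indicator_of_mem (show s ∈ Ici (0:ℝ) from hs.1.le)]

theorem U_bound {β F : ℝ → ℝ} {U : ℝ → ℝ → ℝ} (hβ : Continuous β) (h0 : ∀ a, 0 ≤ β a)
    (hU : ∀ a t, 0 ≤ t → U a t = F a * E β a 0 t
      + 2 * ∫ s in (0:ℝ)..t, β (a - s) * E β a s t * U (a - Real.log 2) s)
    (hbd : ∀ a0 T, ∃ K, ∀ a ≤ a0, ∀ t, 0 ≤ t → t ≤ T → |U a t| ≤ K)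
    {a0 T K C : ℝ} (hC : ∀ a ≤ a0, β a ≤ C)
    (hK : ∀ a ≤ a0, ∀ t, 0 ≤ t → t ≤ T → |U a t| ≤ K) (n : ℕ) :
    ∀ a ≤ a0, ∀ t, 0 ≤ t → t ≤ T →
      |U a t - ∑ k ∈ Finset.range n, P β k a t * F (a - k * Real.log 2)|
        ≤ K * ((2 * C) ^ n * t ^ n / n.factorial) := by
  have hl : 0 < Real.log 2 := Real.log_pos (by norm_num)
  have hC0 : 0 ≤ C := (h0 a0).trans (hC a0 le_rfl)
  induction n with
  | zero => intro a ha t ht htT; simpa using hK a ha t ht htT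
  | succ n ih =>
    intro a ha t ht htT
    have hcE : Continuous fun s => β (a - s) * E β a s t :=
      (by fun_prop : Continuous fun s => β (a - s)).mul
        ((cont_E hβ).comp (by fun_prop : Continuous fun s : ℝ => (a, s, t)))
    have hcP : ∀ k, Continuous fun s => P β k (a - Real.log 2) s := fun k =>
      (cont_P hβ k).comp (by fun_prop : Continuous fun s : ℝ => (a - Real.log 2, s))
    have hUi := U_int hβ hU hbd (a - Real.log 2) t ht
    have hS : Continuous fun s => ∑ k ∈ Finset.range n,
        P β k (a - Real.log 2) s * F (a - Real.log 2 - k * Real.log 2) :=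
      continuous_finsetSum _ fun k _ => (hcP k).mul continuous_const
    have key : U a t - ∑ k ∈ Finset.range (n + 1), P β k a t * F (a - k * Real.log 2)
        = 2 * ∫ s in (0:ℝ)..t, β (a - s) * E β a s t * (U (a - Real.log 2) s -
          ∑ k ∈ Finset.range n,
            P β k (a - Real.log 2) s * F (a - Real.log 2 - k * Real.log 2)) := by
      rw [Finset.sum_range_succ']
      have e1 : ∫ s in (0:ℝ)..t, β (a - s) * E β a s t * (U (a - Real.log 2) s -
          ∑ k ∈ Finset.range n,
            P β k (a - Real.log 2) s * F (a - Real.log 2 - k * Real.log 2))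
          = (∫ s in (0:ℝ)..t, β (a - s) * E β a s t * U (a - Real.log 2) s)
            - ∑ k ∈ Finset.range n, (∫ s in (0:ℝ)..t, β (a - s) * E β a s t *
               P β k (a - Real.log 2) s) * F (a - Real.log 2 - k * Real.log 2) := by
        simp_rw [mul_sub]
        rw [intervalIntegral.integral_sub (hUi.continuousOn_mul hcE.continuousOn)
          (Continuous.intervalIntegrable (by exact hcE.mul hS) _ _)]
        congr 1
        simp_rw [Finset.mul_sum]
        rw [intervalIntegral.integral_finsetSum fun k _ => Continuous.intervalIntegrable
          (by exact hcE.mul ((hcP k).mul continuous_const)) _ _]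
        refine Finset.sum_congr rfl fun k _ => ?_
        rw [← intervalIntegral.integral_mul_const]
        congr 1; funext s; ring
      rw [e1, hU a t ht]
      have e2 : ∑ k ∈ Finset.range n, P β (k + 1) a t * F (a - ((k + 1 : ℕ) : ℝ) * Real.log 2)
          = 2 * ∑ k ∈ Finset.range n, (∫ s in (0:ℝ)..t, β (a - s) * E β a s t *
               P β k (a - Real.log 2) s) * F (a - Real.log 2 - k * Real.log 2) := by
        rw [Finset.mul_sum]
        refine Finset.sum_congr rfl fun k _ => ?_
        simp only [P]
        rw [mul_assoc]
        rw [show a - ((k + 1 : ℕ) : ℝ) * Real.log 2 = a - Real.log 2 - k * Real.log 2 by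
          push_cast; ring]
      rw [e2]
      simp only [P, Nat.cast_zero, zero_mul, sub_zero]
      ring
    rw [key, abs_mul, abs_two]
    have hb : ‖∫ s in (0:ℝ)..t, β (a - s) * E β a s t * (U (a - Real.log 2) s -
          ∑ k ∈ Finset.range n,
            P β k (a - Real.log 2) s * F (a - Real.log 2 - k * Real.log 2))‖
        ≤ ∫ s in (0:ℝ)..t, C * (K * ((2 * C) ^ n * s ^ n / n.factorial)) := by
      apply intervalIntegral.norm_integral_le_of_norm_le ht
      · refine Eventually.of_forall fun s hs => ?_
        rw [Real.norm_eq_abs, abs_mul]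
        have i1 := ih (a - Real.log 2) (by linarith) s hs.1.le (hs.2.trans htT)
        have i2 : |β (a - s) * E β a s t| ≤ C := by
          rw [abs_of_nonneg (mul_nonneg (h0 _) (E_pos _ _ _ _).le)]
          calc _ ≤ β (a - s) * 1 := mul_le_mul_of_nonneg_left (E_le_one h0 a hs.2) (h0 _)
            _ ≤ C := by rw [mul_one]; exact hC _ (by linarith [hs.1])
        exact mul_le_mul i2 i1 (abs_nonneg _) hC0
      · exact Continuous.intervalIntegrable (by fun_prop) _ _
    rw [Real.norm_eq_abs] at hb
    have e3 : ∫ s in (0:ℝ)..t, C * (K * ((2 * C) ^ n * s ^ n / n.factorial))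
        = C * K * (2 * C) ^ n / n.factorial * (t ^ (n + 1) / (n + 1)) := by
      have : (fun s : ℝ => C * (K * ((2 * C) ^ n * s ^ n / n.factorial)))
          = fun s => (C * K * (2 * C) ^ n / n.factorial) * s ^ n := by
        funext s; ring
      rw [this, intervalIntegral.integral_const_mul, integral_pow]
      simp
    rw [e3] at hb
    refine (mul_le_mul_of_nonneg_left hb (by norm_num : (0:ℝ) ≤ 2)).trans (le_of_eq ?_)
    rw [Nat.factorial_succ]
    push_cast
    have : (n.factorial : ℝ) ≠ 0 := by positivity
    field_simp
    ring

theorem U_series {β F : ℝ → ℝ} {U : ℝ → ℝ → ℝ} (hβ : Continuous β) (h0 : ∀ a, 0 ≤ β a)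
    (hb : ∀ a0, ∃ C, ∀ a ≤ a0, β a ≤ C)
    (hU : ∀ a t, 0 ≤ t → U a t = F a * E β a 0 t
      + 2 * ∫ s in (0:ℝ)..t, β (a - s) * E β a s t * U (a - Real.log 2) s)
    (hbd : ∀ a0 T, ∃ K, ∀ a ≤ a0, ∀ t, 0 ≤ t → t ≤ T → |U a t| ≤ K) (a t : ℝ) (ht : 0 ≤ t) :
    Tendsto (fun n => ∑ k ∈ Finset.range n, P β k a t * F (a - k * Real.log 2)) atTop
      (𝓝 (U a t)) := by
  obtain ⟨C, hC⟩ := hb a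
  obtain ⟨K, hK⟩ := hbd a t
  have h := fun n => U_bound hβ h0 hU hbd hC hK n a le_rfl t ht le_rfl
  have hz : Tendsto (fun n : ℕ => K * ((2 * C) ^ n * t ^ n / n.factorial)) atTop (𝓝 0) := by
    have := (FloorSemiring.tendsto_pow_div_factorial_atTop (2 * C * t)).const_mul K
    simpa [mul_pow] using this
  have h2 := squeeze_zero (fun n => abs_nonneg _) h hz
  have h3 := (tendsto_zero_iff_abs_tendsto_zero _).2 h2
  have h4 := (tendsto_const_nhds (x := U a t)).sub h3
  simpa using h4

/-- series representation of mild solutions -/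
theorem mild_series {B f : ℝ → ℝ} {φ : ℝ → ℝ → ℝ} (hB : Bhyp B) (hl : LocBdd2 φ)
    (hφ : IsMildSol B f φ) (t : ℝ) (ht : 0 ≤ t) (x : ℝ) (hx : 0 < x) :
    Tendsto (fun n => ∑ k ∈ Finset.range n,
      P (fun a => B (Real.exp a)) k (Real.log x + t) t * f (x * Real.exp t / 2 ^ k)) atTop
      (𝓝 (φ t x)) := by
  obtain ⟨hc, h0, ε, hε, C, hC⟩ := hB
  set β : ℝ → ℝ := fun a => B (Real.exp a) with hβd
  have hβ : Continuous β := hc.comp_continuous Real.continuous_exp fun a => Real.exp_pos a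
  have hβ0 : ∀ a, 0 ≤ β a := fun a => h0 _ (Real.exp_pos a)
  have hb : ∀ a0, ∃ C, ∀ a ≤ a0, β a ≤ C := by
    intro a0
    obtain ⟨C', hC'⟩ := (isCompact_Icc (a := Real.log ε - 1) (b := a0)).bddAbove_image
      hβ.continuousOn
    refine ⟨max C C', fun a ha => ?_⟩
    by_cases h : a < Real.log ε - 1
    · refine le_max_of_le_left (hC _ (Real.exp_pos a) ?_)
      rw [← Real.lt_log_iff_exp_lt hε]; linarith
    · exact le_max_of_le_right (hC' ⟨a, ⟨not_lt.1 h, ha⟩, rfl⟩)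
  have hU : ∀ a t, 0 ≤ t → φ t (Real.exp (a - t)) = f (Real.exp a) * E β a 0 t
      + 2 * ∫ s in (0:ℝ)..t, β (a - s) * E β a s t * φ s (Real.exp (a - Real.log 2 - s)) := by
    intro a t ht
    rw [hφ t ht _ (Real.exp_pos _)]
    have e1 : ∀ s, Real.exp (a - t) * Real.exp s = Real.exp (a - (t - s)) := fun s => by
      rw [← Real.exp_add]; ring_nf
    have e2 : ∀ u, (∫ s in (0:ℝ)..u, B (Real.exp (a - t) * Real.exp s))
        = ∫ r in (t - u)..t, β (a - r) := by
      intro u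
      simp_rw [e1]
      have := intervalIntegral.integral_comp_sub_left (a := 0) (b := u) (fun r => β (a - r)) t
      rw [sub_zero] at this
      exact this
    congr 1
    · rw [e1, e2]; simp [E]
    · congr 1
      have := intervalIntegral.integral_comp_sub_left (a := 0) (b := t)
        (fun s => β (a - s) * E β a s t * φ s (Real.exp (a - Real.log 2 - s))) t
      rw [sub_zero, sub_self] at this
      rw [← this]
      congr 1
      funext τ
      rw [e2, e1]
      simp only [E, hβd]
      congr 2
      rw [show a - Real.log 2 - (t - τ) = a - (t - τ) - Real.log 2 by ring, Real.exp_sub _ (Real.log 2),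
        Real.exp_log (by norm_num)]
  have hbd : ∀ a0 T, ∃ K, ∀ a ≤ a0, ∀ t, 0 ≤ t → t ≤ T → |φ t (Real.exp (a - t))| ≤ K := by
    intro a0 T
    obtain ⟨K, hK⟩ := hl (max (Real.exp a0) T) (lt_max_of_lt_left (Real.exp_pos _))
    refine ⟨K, fun a ha t ht hT => hK t _ ht (le_max_of_le_right hT) (Real.exp_pos _)
      (le_max_of_le_left (Real.exp_le_exp.2 (by linarith)))⟩
  have := U_series (F := fun a => f (Real.exp a)) (U := fun a t => φ t (Real.exp (a - t)))
    hβ hβ0 hb hU hbd (Real.log x + t) t ht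
  simp only [add_sub_cancel_right, Real.exp_log hx] at this
  refine this.congr fun n => Finset.sum_congr rfl fun k _ => ?_
  rw [Real.exp_sub, Real.exp_add, Real.exp_log hx, Real.exp_nat_mul, Real.exp_log (by norm_num)]

theorem id_mild {B : ℝ → ℝ} (hB : Bhyp B) : IsMildSol B (fun x => x) (fun t x => x * Real.exp t) := by
  intro t ht x hx
  have hc : Continuous fun s => B (x * Real.exp s) :=
    hB.1.comp_continuous (by fun_prop) fun s => mul_pos hx (Real.exp_pos s)
  have hd : ∀ τ, HasDerivAt (fun τ => -Real.exp (-∫ s in (0:ℝ)..τ, B (x * Real.exp s)))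
      (B (x * Real.exp τ) * Real.exp (-∫ s in (0:ℝ)..τ, B (x * Real.exp s))) τ := by
    intro τ
    have h1 := (hc.integral_hasStrictDerivAt 0 τ).hasDerivAt
    exact h1.neg.exp.neg.congr_deriv (by simp only [Pi.neg_apply]; ring)
  have hcc : Continuous fun τ =>
      B (x * Real.exp τ) * Real.exp (-∫ s in (0:ℝ)..τ, B (x * Real.exp s)) := by
    refine hc.mul (Real.continuous_exp.comp (Continuous.neg ?_))
    exact intervalIntegral.continuous_primitive (fun a b => hc.intervalIntegrable a b) 0
  have hi := intervalIntegral.integral_eq_sub_of_hasDerivAt (a := 0) (b := t)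
    (fun τ _ => hd τ) (hcc.intervalIntegrable _ _)
  have : (fun τ => B (x * Real.exp τ) * Real.exp (-∫ s in (0:ℝ)..τ, B (x * Real.exp s)) *
      (x * Real.exp τ / 2 * Real.exp (t - τ))) = fun τ => (B (x * Real.exp τ) *
      Real.exp (-∫ s in (0:ℝ)..τ, B (x * Real.exp s))) * (x * Real.exp t / 2) := by
    funext τ
    rw [Real.exp_sub]
    field_simp
  simp only [this]
  rw [intervalIntegral.integral_mul_const, hi]
  simp
  ring

theorem id_locBdd : LocBdd2 (fun t x => x * Real.exp t) := by
  intro r hr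
  refine ⟨r * Real.exp r, fun t x ht htr hx hxr => ?_⟩
  rw [abs_of_pos (mul_pos hx (Real.exp_pos t))]
  exact mul_le_mul hxr (Real.exp_le_exp.2 htr) (Real.exp_pos t).le hr.le

end Mito

namespace Mito

/-- the weights as a function of the original variable -/
def W (B : ℝ → ℝ) (t : ℝ) (n : ℕ) (x : ℝ) : ℝ :=
  P (fun a => B (Real.exp a)) n (Real.log x + t) t

theorem W_meas {B : ℝ → ℝ} (hB : Bhyp B) (t : ℝ) (n : ℕ) : Measurable (W B t n) := by
  have hβ : Continuous fun a => B (Real.exp a) :=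
    hB.1.comp_continuous Real.continuous_exp fun a => Real.exp_pos a
  exact (cont_P hβ n).measurable.comp
    ((Real.measurable_log.add_const t).prodMk measurable_const)

theorem W_nonneg {B : ℝ → ℝ} (hB : Bhyp B) {t : ℝ} (ht : 0 ≤ t) (n : ℕ) (x : ℝ) :
    0 ≤ W B t n x :=
  P_nonneg (fun a => hB.2.1 _ (Real.exp_pos a)) n _ ht

/-- the kernel applied to a nonnegative function -/
def Q (B : ℝ → ℝ) (t : ℝ) (g : ℝ → ENNReal) (x : ℝ) : ENNReal :=
  ∑' n, ENNReal.ofReal (W B t n x) * g (x * Real.exp t / 2 ^ n)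

/-- the measure `µM_t` -/
def N (B : ℝ → ℝ) (t : ℝ) (μ : Measure ℝ) : Measure ℝ :=
  Measure.sum fun n => ((μ.restrict (Ioi 0)).withDensity fun x =>
    ENNReal.ofReal (W B t n x)).map fun x => x * Real.exp t / 2 ^ n

theorem Q_meas {B : ℝ → ℝ} (hB : Bhyp B) (t : ℝ) {g : ℝ → ENNReal} (hg : Measurable g) :
    Measurable (Q B t g) := by
  unfold Q
  refine Measurable.tsum fun n => ?_
  exact (W_meas hB t n).ennreal_ofReal.mul (hg.comp (by fun_prop))

theorem lint_N {B : ℝ → ℝ} (hB : Bhyp B) (t : ℝ) (μ : Measure ℝ) {g : ℝ → ENNReal}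
    (hg : Measurable g) : ∫⁻ x, g x ∂(N B t μ) = ∫⁻ x in Ioi 0, Q B t g x ∂μ := by
  unfold N Q
  rw [lintegral_sum_measure, lintegral_tsum]
  · refine tsum_congr fun n => ?_
    rw [lintegral_map hg (by fun_prop),
      lintegral_withDensity_eq_lintegral_mul _ (W_meas hB t n).ennreal_ofReal
        (show Measurable fun x => g (x * Real.exp t / 2 ^ n) from hg.comp (by fun_prop))]
    rfl
  · intro n
    exact ((W_meas hB t n).ennreal_ofReal.mul (hg.comp (by fun_prop))).aemeasurable

theorem Q_eq {B g : ℝ → ℝ} {φ : ℝ → ℝ → ℝ} (hB : Bhyp B) (hl : LocBdd2 φ)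
    (hφ : IsMildSol B g φ) (hg : ∀ x > 0, 0 ≤ g x) {t : ℝ} (ht : 0 ≤ t) {x : ℝ} (hx : 0 < x) :
    Q B t (fun y => ENNReal.ofReal (g y)) x = ENNReal.ofReal (φ t x) ∧ 0 ≤ φ t x := by
  have h := mild_series hB hl hφ t ht x hx
  have hn : ∀ n, 0 ≤ W B t n x * g (x * Real.exp t / 2 ^ n) := fun n =>
    mul_nonneg (W_nonneg hB ht n x) (hg _ (by positivity))
  have hs := (hasSum_iff_tendsto_nat_of_nonneg hn (φ t x)).2 h
  refine ⟨?_, hs.nonneg hn⟩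
  rw [← hs.tsum_eq, ENNReal.ofReal_tsum_of_nonneg hn hs.summable]
  unfold Q
  exact tsum_congr fun n => (ENNReal.ofReal_mul (W_nonneg hB ht n x)).symm

theorem locBdd_lin {f : ℝ → ℝ} {C : ℝ} (h : ∀ x > 0, |f x| ≤ C * x) : LocBddOn f := by
  intro r hr
  refine ⟨|C| * r, fun x hx hxr => (h x hx).trans ?_⟩
  exact mul_le_mul (le_abs_self C) hxr hx.le (abs_nonneg C)

theorem N_Ioi {B : ℝ → ℝ} (hB : Bhyp B) (t : ℝ) (μ : Measure ℝ) :
    (N B t μ).restrict (Ioi 0) = N B t μ := by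
  rw [Measure.restrict_eq_self_of_ae_mem]
  rw [ae_iff, ← lintegral_indicator_one (by exact measurableSet_Ioi.compl),
    lint_N hB t μ (measurable_one.indicator (by exact measurableSet_Ioi.compl))]
  rw [lintegral_eq_zero_iff' (Q_meas hB t
    (measurable_one.indicator (by exact measurableSet_Ioi.compl))).aemeasurable]
  filter_upwards [ae_restrict_mem measurableSet_Ioi] with x hx
  have hx : 0 < x := hx
  simp only [Q, Pi.zero_apply, ENNReal.tsum_eq_zero]
  intro n
  rw [indicator_of_notMem, mul_zero]
  simp only [mem_ofPred_eq, not_not, mem_Ioi]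
  positivity

end Mito

/-- The left action of `M_t` on a positive measure `µ` with `∫ x dµ < ∞`, defined on Borel sets by
`A ↦ ∫ M_t 1_A dµ`, is a countably additive positive Borel measure `ν = µM_t`; it satisfies
`∫ x dν = eᵗ ∫ x dµ < ∞` and the duality relation `(µM_t)(f) = µ(M_t f)` for every Borel `f`
with `‖f‖_Ḃ < ∞`. -/
theorem stmt6 (B : ℝ → ℝ) (hB : Bhyp B)
    (M : (ℝ → ℝ) → ℝ → ℝ → ℝ)
    (hM : ∀ f, LocBddOn f → LocBdd2 (M f) ∧ IsMildSol B f (M f))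
    (μ : Measure ℝ)
    (hμx : (∫⁻ x in Ioi 0, ENNReal.ofReal x ∂μ) < ⊤)
    (t : ℝ) (ht : 0 ≤ t) :
    ∃ ν : Measure ℝ,
      (∀ A : Set ℝ, MeasurableSet A →
        ν A = ∫⁻ x in Ioi 0, ENNReal.ofReal (M ((A ∩ Ioi 0).indicator 1) t x) ∂μ) ∧
      (∫⁻ x in Ioi 0, ENNReal.ofReal x ∂ν)
        = ENNReal.ofReal (exp t) * ∫⁻ x in Ioi 0, ENNReal.ofReal x ∂μ ∧
      (∀ f : ℝ → ℝ, Measurable f → (∃ C, ∀ x > 0, |f x| ≤ C * x) →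
        (∫ x in Ioi 0, f x ∂ν) = ∫ x in Ioi 0, M f t x ∂μ) := by
  refine ⟨Mito.N B t μ, ?_, ?_, ?_⟩
  · intro A hA
    have hm : MeasurableSet (A ∩ Ioi 0) := hA.inter measurableSet_Ioi
    have h1 : Mito.N B t μ A = Mito.N B t μ (A ∩ Ioi 0) := by
      rw [← Measure.restrict_apply hA, Mito.N_Ioi hB]
    have hgm : Measurable ((A ∩ Ioi 0).indicator (1 : ℝ → ℝ)) := measurable_one.indicator hm
    have h2 : ∀ x, (A ∩ Ioi 0).indicator (1 : ℝ → ENNReal) x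
        = ENNReal.ofReal ((A ∩ Ioi 0).indicator (1 : ℝ → ℝ) x) := by
      intro x
      by_cases h : x ∈ A ∩ Ioi 0
      · simp [indicator_of_mem h]
      · simp [indicator_of_notMem h]
    have hl : LocBddOn ((A ∩ Ioi 0).indicator (1 : ℝ → ℝ)) := by
      intro r _
      refine ⟨1, fun x _ _ => ?_⟩
      by_cases h : x ∈ A ∩ Ioi 0
      · simp [indicator_of_mem h]
      · simp [indicator_of_notMem h]
    rw [h1, ← lintegral_indicator_one hm, lintegral_congr h2,
      Mito.lint_N hB t μ hgm.ennreal_ofReal]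
    refine setLIntegral_congr_fun measurableSet_Ioi fun x hx => ?_
    exact (Mito.Q_eq hB (hM _ hl).1 (hM _ hl).2
      (fun x _ => indicator_nonneg (fun _ _ => zero_le_one) x) ht hx).1
  · rw [Mito.N_Ioi hB, Mito.lint_N hB t μ ENNReal.measurable_ofReal,
      ← lintegral_const_mul _ ENNReal.measurable_ofReal]
    refine setLIntegral_congr_fun measurableSet_Ioi fun x hx => ?_
    have := (Mito.Q_eq hB Mito.id_locBdd (Mito.id_mild hB) (fun x hx => hx.le) ht hx).1
    rw [mul_comm, ← ENNReal.ofReal_mul (le_of_lt hx)]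
    exact this
  · rintro f hf ⟨C, hC⟩
    have hid : ∫⁻ x, ENNReal.ofReal x ∂(Mito.N B t μ) < ⊤ := by
      rw [Mito.lint_N hB t μ ENNReal.measurable_ofReal]
      have : ∫⁻ x in Ioi 0, Mito.Q B t ENNReal.ofReal x ∂μ
          = ENNReal.ofReal (exp t) * ∫⁻ x in Ioi 0, ENNReal.ofReal x ∂μ := by
        rw [← lintegral_const_mul _ ENNReal.measurable_ofReal]
        refine setLIntegral_congr_fun measurableSet_Ioi fun x hx => ?_
        have := (Mito.Q_eq hB Mito.id_locBdd (Mito.id_mild hB) (fun x hx => hx.le) ht hx).1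
        rw [mul_comm, ← ENNReal.ofReal_mul (le_of_lt hx)]
        exact this
      rw [this]
      exact ENNReal.mul_lt_top ENNReal.ofReal_lt_top hμx
    have hpos : ∀ᵐ x ∂(Mito.N B t μ), 0 < x := by
      rw [← Mito.N_Ioi hB]
      exact ae_restrict_mem measurableSet_Ioi
    have hidI : Integrable (fun x : ℝ => x) (Mito.N B t μ) := by
      refine ⟨measurable_id.aestronglyMeasurable, ?_⟩
      rw [hasFiniteIntegral_iff_ofReal (hpos.mono fun x hx => hx.le)]
      exact hid
    have hfI : Integrable f (Mito.N B t μ) := by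
      refine (hidI.const_mul C).mono' hf.aestronglyMeasurable ?_
      exact hpos.mono fun x hx => hC x hx
    have hp : ∀ x > 0, |max (f x) 0| ≤ C * x := fun x hx => by
      rw [abs_of_nonneg (le_max_right _ _)]
      exact max_le ((le_abs_self _).trans (hC x hx)) ((abs_nonneg _).trans (hC x hx))
    have hn : ∀ x > 0, |max (-f x) 0| ≤ C * x := fun x hx => by
      rw [abs_of_nonneg (le_max_right _ _)]
      exact max_le ((neg_le_abs _).trans (hC x hx)) ((abs_nonneg _).trans (hC x hx))
    have hMp := hM _ (Mito.locBdd_lin hp)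
    have hMn := hM _ (Mito.locBdd_lin hn)
    have hMf := hM _ (Mito.locBdd_lin hC)
    have e : ∀ r : ℝ, ENNReal.ofReal (max r 0) = ENNReal.ofReal r := fun r => by
      rw [ENNReal.ofReal_max]; simp
    have qp : ∀ x, 0 < x → M (fun x => max (f x) 0) t x
        = (Mito.Q B t (fun y => ENNReal.ofReal (f y)) x).toReal := by
      intro x hx
      have := Mito.Q_eq hB hMp.1 hMp.2 (fun x _ => le_max_right _ _) ht hx
      simp only [e] at this
      rw [this.1, ENNReal.toReal_ofReal this.2]
    have qn : ∀ x, 0 < x → M (fun x => max (-f x) 0) t x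
        = (Mito.Q B t (fun y => ENNReal.ofReal (-f y)) x).toReal := by
      intro x hx
      have := Mito.Q_eq hB hMn.1 hMn.2 (fun x _ => le_max_right _ _) ht hx
      simp only [e] at this
      rw [this.1, ENNReal.toReal_ofReal this.2]
    have qf : ∀ x, 0 < x → M f t x = (Mito.Q B t (fun y => ENNReal.ofReal (f y)) x).toReal
        - (Mito.Q B t (fun y => ENNReal.ofReal (-f y)) x).toReal := by
      intro x hx
      rw [← qp x hx, ← qn x hx]
      have h1 := Mito.mild_series hB hMp.1 hMp.2 t ht x hx
      have h2 := Mito.mild_series hB hMn.1 hMn.2 t ht x hx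
      have h3 := Mito.mild_series hB hMf.1 hMf.2 t ht x hx
      refine tendsto_nhds_unique h3 ((h1.sub h2).congr fun n => ?_)
      rw [← Finset.sum_sub_distrib]
      refine Finset.sum_congr rfl fun k _ => ?_
      rw [← mul_sub, max_zero_sub_eq_self]
    have mp : Measurable fun y => ENNReal.ofReal (f y) := hf.ennreal_ofReal
    have mn : Measurable fun y => ENNReal.ofReal (-f y) := hf.neg.ennreal_ofReal
    have ip : ∫⁻ x in Ioi 0, Mito.Q B t (fun y => ENNReal.ofReal (f y)) x ∂μ ≠ ⊤ := by
      rw [← Mito.lint_N hB t μ mp]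
      exact hfI.lintegral_lt_top.ne
    have iN : ∫⁻ x in Ioi 0, Mito.Q B t (fun y => ENNReal.ofReal (-f y)) x ∂μ ≠ ⊤ := by
      rw [← Mito.lint_N hB t μ mn]
      exact hfI.neg.lintegral_lt_top.ne
    have ap := (Mito.Q_meas hB t mp).aemeasurable (μ := μ.restrict (Ioi 0))
    have an := (Mito.Q_meas hB t mn).aemeasurable (μ := μ.restrict (Ioi 0))
    rw [setIntegral_congr_fun measurableSet_Ioi fun x hx => qf x hx,
      integral_sub (integrable_toReal_of_lintegral_ne_top ap ip)
        (integrable_toReal_of_lintegral_ne_top an iN),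
      integral_toReal ap (ae_lt_top' ap ip), integral_toReal an (ae_lt_top' an iN),
      Mito.N_Ioi hB, integral_eq_lintegral_pos_part_sub_lintegral_neg_part hfI,
      Mito.lint_N hB t μ mp, Mito.lint_N hB t μ mn]
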